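/- Let ξ be a fixed stack array, η a configuration, and V ⊆ ℤ. If α and β are two toppling sequences legal for η, both contained in V and both stabilizing η in V, then h_α = h_β pointwise; in particular Φ_α(η) = Φ_β(η). Consequently the odometer u_{η,V} of the stabilization of η in V is well defined. -/

import Mathlib

/-!
Activated Random Walk: configurations, stacks, toppling, Abelian property.

Configurations are elements of `Ω = (ℕ ∪ {ρ})^ℤ`; `num n` means `n` active particles,
`rho` a single sleeping particle.  A stack array assigns to each site `x` and each
index `j` an instruction `τ_{x,x-1}`, `τ_{x,x+1}` or `τ_{x,ρ}` (encoded as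
`left`, `right`, `sleep`).  Toppling at `x` uses the first unused instruction of the
stack at `x` (indices start at `0`, i.e. the `(h x + 1)`-st instruction).
-/

/-- The state of a single site: `num n` = `n` active particles, `rho` = one sleeping
particle. -/
inductive ARWState where
  | num : ℕ → ARWState
  | rho : ARWState
deriving DecidableEq

/-- Configurations on `ℤ`. -/
abbrev Config := ℤ → ARWState

/-- Adding one (active) particle to a site: `ρ + 1 = 2`. -/
def ARWState.inc : ARWState → ARWState
  | .num n => .num (n + 1)
  | .rho => .num 2

/-- Removing one active particle from a site (only meaningful at unstable sites). -/
def ARWState.dec : ARWState → ARWState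
  | .num (n + 1) => .num n
  | s => s

/-- The effect of a sleep instruction `τ_{x,ρ}`: `ρ·1 = ρ`, `ρ·n = n` for `n > 1`. -/
def ARWState.toSleep : ARWState → ARWState
  | .num 1 => .rho
  | s => s

/-- A site `x` is unstable in `η` if it carries at least one active particle. -/
def Unstable (η : Config) (x : ℤ) : Prop := ∃ n : ℕ, 1 ≤ n ∧ η x = .num n

/-- The three kinds of instructions at a site `x`: `τ_{x,x-1}`, `τ_{x,x+1}`, `τ_{x,ρ}`. -/
inductive Instr where
  | left : Instr
  | right : Instr
  | sleep : Instr
deriving DecidableEq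

/-- The action of an instruction at site `x` on a configuration. -/
def applyInstr (ι : Instr) (x : ℤ) (η : Config) : Config :=
  match ι with
  | .left => fun z => if z = x then (η x).dec else if z = x - 1 then (η (x - 1)).inc else η z
  | .right => fun z => if z = x then (η x).dec else if z = x + 1 then (η (x + 1)).inc else η z
  | .sleep => fun z => if z = x then (η x).toSleep else η z

/-- A stack array `ξ = (ξ_{(x,j)})`. -/
abbrev Stacks := ℤ → ℕ → Instr

/-- One toppling at `x`, acting on a pair (configuration, odometer): it uses the first
unused instruction `ξ_{(x, h x + 1)}` of the stack at `x` and increases the odometer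
at `x` by one. -/
def toppleOne (ξ : Stacks) (x : ℤ) (p : Config × (ℤ → ℕ)) : Config × (ℤ → ℕ) :=
  (applyInstr (ξ x (p.2 x)) x p.1, Function.update p.2 x (p.2 x + 1))

/-- Toppling along a finite sequence `α = (x₁, …, x_k)`, i.e. `Φ_α = Φ_{x_k} ∘ ⋯ ∘ Φ_{x_1}`. -/
def toppleSeq (ξ : Stacks) : List ℤ → Config × (ℤ → ℕ) → Config × (ℤ → ℕ)
  | [], p => p
  | x :: α, p => toppleSeq ξ α (toppleOne ξ x p)

/-- Legality of a toppling sequence: each successive toppling happens at a site that is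
unstable in the configuration at that stage. -/
def LegalFrom (ξ : Stacks) : List ℤ → Config × (ℤ → ℕ) → Prop
  | [], _ => True
  | x :: α, p => Unstable p.1 x ∧ LegalFrom ξ α (toppleOne ξ x p)

/-- `Φ_α(η)`: the configuration resulting from toppling the sequence `α` starting from `η`
(and odometer `0`). -/
def topple (ξ : Stacks) (α : List ℤ) (η : Config) : Config :=
  (toppleSeq ξ α (η, fun _ => 0)).1

/-- `α` is a legal toppling sequence for `η` (with fresh stacks). -/
def LegalSeq (ξ : Stacks) (α : List ℤ) (η : Config) : Prop :=
  LegalFrom ξ α (η, fun _ => 0)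

/-- A toppling sequence is contained in `V` if all its entries lie in `V`. -/
def ContainedIn (α : List ℤ) (V : Set ℤ) : Prop := ∀ x ∈ α, x ∈ V

/-- `α` stabilizes `η` in `V` if every site of `V` is stable in `Φ_α(η)`. -/
def StabilizesIn (ξ : Stacks) (α : List ℤ) (η : Config) (V : Set ℤ) : Prop :=
  ∀ x ∈ V, ¬ Unstable (topple ξ α η) x

theorem unstable_toppleOne (ξ : Stacks) (p : Config × (ℤ → ℕ)) (x y : ℤ) (hxy : x ≠ y)
    (hx : Unstable p.1 x) : Unstable (toppleOne ξ y p).1 x := by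
  obtain ⟨n, hn, h⟩ := hx
  unfold toppleOne applyInstr Unstable
  cases ξ y (p.2 y) <;> simp only [if_neg hxy]
  · split_ifs with h1
    · rw [← h1, h]; exact ⟨n + 1, by omega, rfl⟩
    · exact ⟨n, hn, h⟩
  · split_ifs with h1
    · rw [← h1, h]; exact ⟨n + 1, by omega, rfl⟩
    · exact ⟨n, hn, h⟩
  · exact ⟨n, hn, h⟩

theorem inc_dec_num (n : ℕ) : ((ARWState.num (n + 1)).inc).dec = ((ARWState.num (n + 1)).dec).inc := rfl

theorem inc_toSleep_num (n : ℕ) :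
    ((ARWState.num (n + 1)).inc).toSleep = ((ARWState.num (n + 1)).toSleep).inc := by
  cases n <;> rfl

theorem toppleOne_comm (ξ : Stacks) (p : Config × (ℤ → ℕ)) (x y : ℤ) (hxy : x ≠ y)
    (hx : Unstable p.1 x) (hy : Unstable p.1 y) :
    toppleOne ξ x (toppleOne ξ y p) = toppleOne ξ y (toppleOne ξ x p) := by
  obtain ⟨n, hn, h⟩ := hx
  obtain ⟨m, hm, h'⟩ := hy
  obtain ⟨n, rfl⟩ : ∃ k, n = k + 1 := ⟨n - 1, by omega⟩
  obtain ⟨m, rfl⟩ : ∃ k, m = k + 1 := ⟨m - 1, by omega⟩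
  obtain ⟨η, g⟩ := p
  simp only at h h'
  unfold toppleOne
  have e1 : Function.update g y (g y + 1) x = g x := Function.update_of_ne hxy _ _
  have e2 : Function.update g x (g x + 1) y = g y := Function.update_of_ne hxy.symm _ _
  simp only [e1, e2]
  refine Prod.ext ?_ (Function.update_comm hxy.symm _ _ _)
  funext z
  have a := inc_dec_num n
  have b := inc_toSleep_num n
  have c := inc_dec_num m
  have d := inc_toSleep_num m
  rw [← h] at a b
  rw [← h'] at c d
  clear h h' e1 e2
  simp only
  generalize ξ x (g x) = i
  generalize ξ y (g y) = j
  by_cases zx : z = x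
  · subst zx
    cases i <;> cases j <;> simp only [applyInstr] <;> grind
  · by_cases zy : z = y
    · subst zy
      cases i <;> cases j <;> simp only [applyInstr] <;> grind
    · cases i <;> cases j <;> simp only [applyInstr] <;> grind

theorem move_front (ξ : Stacks) (x : ℤ) (β : List ℤ) : ∀ p : Config × (ℤ → ℕ),
    LegalFrom ξ β p → Unstable p.1 x → x ∈ β →
    ∃ β', β.Perm (x :: β') ∧ LegalFrom ξ (x :: β') p ∧
      toppleSeq ξ β p = toppleSeq ξ (x :: β') p := by
  induction β with
  | nil => intro p _ _ h; simp at h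
  | cons y β ih =>
    intro p hl hx hm
    by_cases hxy : x = y
    · subst hxy; exact ⟨β, List.Perm.refl _, hl, rfl⟩
    · have hm' : x ∈ β := by simpa [hxy] using hm
      obtain ⟨γ, h1, h2, h3⟩ := ih _ hl.2 (unstable_toppleOne ξ p x y hxy hx) hm'
      have hc := toppleOne_comm ξ p x y hxy hx hl.1
      refine ⟨y :: γ, (h1.cons y).trans (List.Perm.swap _ _ _), ⟨hx, ?_, ?_⟩, ?_⟩
      · exact unstable_toppleOne ξ p y x (Ne.symm hxy) hl.1
      · rw [← hc]; exact h2.2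
      · simp only [toppleSeq] at h3 ⊢
        rw [h3, hc]

theorem mem_of_stab (ξ : Stacks) (x : ℤ) (β : List ℤ) : ∀ p : Config × (ℤ → ℕ),
    Unstable p.1 x → ¬ Unstable (toppleSeq ξ β p).1 x → x ∈ β := by
  induction β with
  | nil => intro p h h'; exact absurd h h'
  | cons y β ih =>
    intro p h h'
    by_cases hxy : x = y
    · simp [hxy]
    · exact List.mem_cons_of_mem _ (ih _ (unstable_toppleOne ξ p x y hxy h) h')

theorem abelian_aux (ξ : Stacks) (V : Set ℤ) (α : List ℤ) : ∀ (β : List ℤ) (p : Config × (ℤ → ℕ)),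
    LegalFrom ξ α p → ContainedIn α V → (∀ x ∈ V, ¬ Unstable (toppleSeq ξ α p).1 x) →
    LegalFrom ξ β p → ContainedIn β V → (∀ x ∈ V, ¬ Unstable (toppleSeq ξ β p).1 x) →
    α.Perm β ∧ toppleSeq ξ α p = toppleSeq ξ β p := by
  induction α with
  | nil =>
    intro β p _ _ hs hl hc _
    cases β with
    | nil => exact ⟨List.Perm.refl _, rfl⟩
    | cons y β => exact absurd hl.1 (hs y (hc y (by simp)))
  | cons x α ih =>
    intro β p hl hc hs hl' hc' hs'
    have hm := mem_of_stab ξ x β p hl.1 (hs' x (hc x (by simp)))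
    obtain ⟨γ, h1, h2, h3⟩ := move_front ξ x β p hl' hl.1 hm
    rw [h3] at hs' ⊢
    obtain ⟨k1, k2⟩ := ih γ (toppleOne ξ x p) hl.2 (fun z hz => hc z (by simp [hz])) hs h2.2
      (fun z hz => hc' z (h1.symm.subset (by simp [hz]))) hs'
    exact ⟨(k1.cons x).trans h1.symm, k2⟩

/-- **Uniqueness of the stabilizing odometer.**  If `α` and `β` are legal toppling sequences
for `η`, both contained in `V` and both stabilizing `η` in `V`, then `h_α = h_β` pointwise
and `Φ_α(η) = Φ_β(η)`.  Consequently the odometer `u_{η,V}` of the stabilization of `η`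
in `V` is well defined. -/
theorem stabilization_unique (ξ : Stacks) (η : Config) (V : Set ℤ) (α β : List ℤ)
    (hαleg : LegalSeq ξ α η) (hαV : ContainedIn α V) (hαstab : StabilizesIn ξ α η V)
    (hβleg : LegalSeq ξ β η) (hβV : ContainedIn β V) (hβstab : StabilizesIn ξ β η V) :
    (∀ x : ℤ, α.count x = β.count x) ∧ topple ξ α η = topple ξ β η := by
  have h := abelian_aux ξ V α β (η, fun _ => 0) hαleg hαV hαstab hβleg hβV hβstab
  exact ⟨fun x => h.1.count_eq x, congrArg Prod.fst h.2⟩
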